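/- Let q : ℝᵈ → ℝ be differentiable at x ∈ ℝᵈ with gradient g = ∇q(x) ≠ 0, let a ∈ ℝᵈ, let η > 0, and set λ = max((η‖g‖² - ⟪a, g⟫)/‖g‖², 0) and δ = a + λ·g. Then the directional derivative of q at x in the direction -δ equals -⟪g, δ⟫ = -max(⟪a, g⟫, η‖g‖²) ≤ -η‖g‖² < 0; in particular, -δ is a strict descent direction for q at x. -/

import Mathlib

open scoped RealInnerProductSpace

/-- With the dynamic barrier rule, whenever the constraint gradient
`g = ∇q(x)` is nonzero, the negative update direction `-δ = -(a + λ g)` is a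
strict descent direction for `q` at `x`: the directional derivative equals
`-⟪g, δ⟫ = -max(⟪a, g⟫, η‖g‖²) ≤ -η‖g‖² < 0`. -/
theorem stmt_7 {d : ℕ}
    (q : EuclideanSpace ℝ (Fin d) → ℝ) (x g : EuclideanSpace ℝ (Fin d))
    (hq : HasGradientAt q g x) (hg : g ≠ 0)
    (a : EuclideanSpace ℝ (Fin d)) (η : ℝ) (hη : 0 < η)
    (lam : ℝ) (hlam : lam = max ((η * ‖g‖ ^ 2 - ⟪a, g⟫) / ‖g‖ ^ 2) 0)
    (δ : EuclideanSpace ℝ (Fin d)) (hδ : δ = a + lam • g) :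
    fderiv ℝ q x (-δ) = -⟪g, δ⟫ ∧
    -⟪g, δ⟫ = -max ⟪a, g⟫ (η * ‖g‖ ^ 2) ∧
    -⟪g, δ⟫ ≤ -(η * ‖g‖ ^ 2) ∧
    -(η * ‖g‖ ^ 2) < 0 := by
  have hg2 : 0 < ‖g‖ ^ 2 := by positivity
  have hinner : ⟪g, δ⟫ = max ⟪a, g⟫ (η * ‖g‖ ^ 2) := by
    rw [hδ, inner_add_right, real_inner_smul_right, real_inner_self_eq_norm_sq,
      real_inner_comm, hlam, max_mul_of_nonneg _ _ hg2.le, div_mul_cancel₀ _ hg2.ne', zero_mul,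
      ← max_add_add_left, add_sub_cancel, add_zero, max_comm]
  refine ⟨?_, by rw [hinner], ?_, neg_neg_of_pos (mul_pos hη hg2)⟩
  · rw [hq.hasFDerivAt.fderiv, InnerProductSpace.toDual_apply_apply, inner_neg_right]
  · rw [hinner]
    exact neg_le_neg (le_max_right _ _)
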